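/- (Morris constant term identity, half-integer parameter form.) Let n ≥ 1, let a, b be nonnegative integers with a ≥ 1, and let m be a positive integer (playing the role of 2c, c = m/2). Let K be the field of iterated formal Laurent series ℚ((x_n))((x_{n-1}))...((x_1)). Then the coefficient of x_1^0 x_2^0 ⋯ x_n^0 in the element ∏_{i=1}^{n} (1-x_i)^{-a} · ∏_{i=1}^{n} x_i^{-b} · ∏_{1 ≤ i < j ≤ n} (x_j - x_i)^{-m} of K equals (1/n!) · ∏_{j=0}^{n-1} [Γ(a + b + (n-1+j)·m/2) · Γ(m/2)] / [Γ(a + j·m/2) · Γ(m/2 + j·m/2) · Γ(b + j·m/2 + 1)], where Γ is the real Gamma function (all arguments in the products are positive reals, and the coefficient, a rational number, is viewed as a real number). -/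

import Mathlib

/-- Auxiliary: the iterated Laurent series field `ℚ((x_n))((x_{n-1}))⋯((x_1))`,
built by recursion and bundled with its field structure (each step adjoins a new,
more infinitesimal, Laurent variable on the outside). -/
noncomputable def IterLaurentAux : ℕ → (K : Type) × Field K
  | 0 => ⟨ℚ, inferInstance⟩
  | n + 1 =>
    letI := (IterLaurentAux n).2
    ⟨LaurentSeries (IterLaurentAux n).1, inferInstance⟩

/-- `IterLaurent n` is the iterated formal Laurent series field
`ℚ((x_n))((x_{n-1}))⋯((x_1))`, in which `x_i` is infinitesimal with respect to
`x_j` for `i < j`. -/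
noncomputable def IterLaurent (n : ℕ) : Type := (IterLaurentAux n).1

noncomputable instance (n : ℕ) : Field (IterLaurent n) := (IterLaurentAux n).2

/-- The variables: `IterLaurent.X n i` is `x_{i+1}` (0-indexed). The variable of
index `0`, i.e. `x_1`, is the outermost, most infinitesimal, Laurent variable;
the remaining variables are included from `IterLaurent n` via the constant
embedding `HahnSeries.C`. -/
noncomputable def IterLaurent.X : ∀ n, Fin n → IterLaurent n
  | n + 1, i =>
    show LaurentSeries (IterLaurent n) from
      Fin.cases (HahnSeries.single (1 : ℤ) (1 : IterLaurent n))
        (fun j => HahnSeries.C (IterLaurent.X n j)) i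

/-- The constant term `CT_{x_n} ⋯ CT_{x_1}`: the coefficient of the monomial
`x_1^0 x_2^0 ⋯ x_n^0` of an iterated Laurent series. -/
noncomputable def IterLaurent.CT : ∀ n, IterLaurent n → ℚ
  | 0, f => f
  | n + 1, f => IterLaurent.CT n ((show LaurentSeries (IterLaurent n) from f).coeff 0)
open Finset

section LogDerivative

variable {L : Type*} [Field L] (D : Derivation ℤ L L)

theorem Derivation.apply_mul_of_log {u v α β : L} (hu : D u = u * α) (hv : D v = v * β) :
    D (u * v) = u * v * (α + β) := by
  rw [D.leibniz, hu, hv, smul_eq_mul, smul_eq_mul]; ring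

theorem Derivation.apply_inv_pow_of_log {u α : L} (hu : D u = u * α) (k : ℕ) :
    D ((u ^ k)⁻¹) = (u ^ k)⁻¹ * (-(k * α)) := by
  rcases eq_or_ne u 0 with rfl | h0
  · rcases k with _ | k <;> simp
  induction k with
  | zero => simp
  | succ k ih =>
    have h1 : D u⁻¹ = u⁻¹ * (-α) := by
      rw [D.leibniz_inv, hu, smul_eq_mul]; field_simp
    rw [pow_succ, mul_inv, D.apply_mul_of_log ih h1]
    push_cast; ring

theorem Derivation.apply_prod_of_log {κ : Type*} (s : Finset κ) {u α : κ → L}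
    (h : ∀ i ∈ s, D (u i) = u i * α i) :
    D (∏ i ∈ s, u i) = (∏ i ∈ s, u i) * ∑ i ∈ s, α i := by
  classical
  induction s using Finset.induction_on with
  | empty => simp
  | insert i s hi ih =>
    rw [prod_insert hi, sum_insert hi]
    exact D.apply_mul_of_log (h i (mem_insert_self _ _))
      (ih fun j hj => h j (mem_insert_of_mem hj))

end LogDerivative

/-- The Morris integrand `∏ (1 - x_i)^{-a} ∏ x_i^{-b} ∏_{i < j} (x_j - x_i)^{-m}`. -/
noncomputable def morrisWeight {L : Type*} [Field L] {n : ℕ} (x : Fin n → L) (a b m : ℕ) : L :=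
  (∏ i : Fin n, ((1 - x i) ^ a)⁻¹) * (∏ i : Fin n, ((x i) ^ b)⁻¹) *
    ∏ p ∈ Finset.univ.filter (fun p : Fin n × Fin n => p.1 < p.2), ((x p.2 - x p.1) ^ m)⁻¹

/-- The diagonal term `j = i` of the sum vanishes since `y / 0 = 0`. -/
theorem derivation_morrisWeight {L : Type*} [Field L] {n : ℕ} {x : Fin n → L}
    (hx : Function.Injective x) (hx1 : ∀ i, x i ≠ 1) (a b m : ℕ) (i : Fin n)
    (D : Derivation ℤ L L) (hD : ∀ j, D (x j) = if j = i then x j else 0) :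
    D (morrisWeight x a b m) = morrisWeight x a b m *
      (a * x i / (1 - x i) - b + m * ∑ j, x i / (x j - x i)) := by
  have h1 : ∀ j ∈ (univ : Finset (Fin n)), D ((1 - x j) ^ a)⁻¹ =
      ((1 - x j) ^ a)⁻¹ * (-(a * (if j = i then -x i / (1 - x i) else 0))) := fun j _ => by
    apply D.apply_inv_pow_of_log
    have := sub_ne_zero.2 (hx1 j).symm
    rw [map_sub, D.map_one_eq_zero, hD]
    split_ifs with h
    · subst h; field_simp; ring
    · simp
  have h2 : ∀ j ∈ (univ : Finset (Fin n)), D ((x j) ^ b)⁻¹ =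
      ((x j) ^ b)⁻¹ * (-(b * (if j = i then 1 else 0))) := fun j _ => by
    apply D.apply_inv_pow_of_log
    rw [hD]; split_ifs <;> simp
  have h3 : ∀ p ∈ univ.filter (fun p : Fin n × Fin n => p.1 < p.2),
      D ((x p.2 - x p.1) ^ m)⁻¹ = ((x p.2 - x p.1) ^ m)⁻¹ *
        (-(m * ((if p.2 = i then x i / (x i - x p.1) else 0) -
          (if p.1 = i then x i / (x p.2 - x i) else 0)))) := fun p hp => by
    apply D.apply_inv_pow_of_log
    have hlt := (mem_filter.1 hp).2
    have := sub_ne_zero.2 (hx.ne hlt.ne')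
    rw [map_sub, hD, hD]
    by_cases h2 : p.2 = i <;> by_cases h1 : p.1 = i
    · omega
    · subst h2; simp only [h1, if_true, if_false, sub_zero]; field_simp
    · subst h1; simp only [h2, if_true, if_false, zero_sub]; field_simp
    · simp [h1, h2]
  have key : ∑ p ∈ univ.filter (fun p : Fin n × Fin n => p.1 < p.2),
      (-((m : L) * ((if p.2 = i then x i / (x i - x p.1) else 0) -
          (if p.1 = i then x i / (x p.2 - x i) else 0)))) =
      m * ∑ j, x i / (x j - x i) := by
    rw [sum_filter, Fintype.sum_prod_type, mul_sum]
    have e : ∀ p q : Fin n, (if p < q then (-((m : L) * ((if q = i then x i / (x i - x p) else 0) -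
          (if p = i then x i / (x q - x i) else 0)))) else 0) =
        (if q = i then (if p < i then m * (x i / (x p - x i)) else 0) else 0) +
        (if p = i then (if i < q then m * (x i / (x q - x i)) else 0) else 0) := by
      intro p q
      have hneg : x i / (x i - x p) = -(x i / (x p - x i)) := by
        rw [← neg_sub (x p), div_neg]
      rw [hneg]
      split_ifs <;> first | (subst_vars; omega) | ring
    simp only [e, sum_add_distrib]
    rw [sum_comm (s := univ) (t := univ) (f := fun p q => if p = i then
      (if i < q then (m : L) * (x i / (x q - x i)) else 0) else 0)]
    simp only [sum_ite_eq', mem_univ, if_true]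
    rw [← sum_add_distrib]
    refine sum_congr rfl fun j _ => ?_
    rcases lt_trichotomy j i with h | h | h
    · simp [h, h.not_gt]
    · simp [h]
    · simp [h, h.not_gt]
  rw [morrisWeight, D.apply_mul_of_log (D.apply_mul_of_log (D.apply_prod_of_log _ h1)
    (D.apply_prod_of_log _ h2)) (D.apply_prod_of_log _ h3), key]
  simp only [sum_neg_distrib, ← mul_sum, sum_ite_eq', mem_univ, if_true]
  ring

section Aomoto

variable {ι L : Type*} [Fintype ι] [DecidableEq ι] [Field L]

/-- The symmetrized functional of the Aomoto argument, evaluated on the monomial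
`∏_{i ∈ S} x_i`. -/
noncomputable def aomotoMean (T : L →+ ℚ) (x : ι → L) (w : L) (S : Finset ι) : ℚ :=
  ∑ σ : Equiv.Perm ι, T ((∏ i ∈ S, x (σ i)) * w)

theorem aomotoMean_insert_eq (T : L →+ ℚ) (x : ι → L) (w : L) {S : Finset ι} {p j : ι}
    (hp : p ∉ S) (hj : j ∉ S) :
    aomotoMean T x w (insert j S) = aomotoMean T x w (insert p S) := by
  unfold aomotoMean
  rw [← Equiv.sum_comp (Equiv.mulRight (Equiv.swap p j))]
  refine sum_congr rfl fun σ _ => ?_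
  rw [prod_insert hp, prod_insert hj]
  have : ∏ i ∈ S, x ((Equiv.mulRight (Equiv.swap p j)) σ i) = ∏ i ∈ S, x (σ i) :=
    prod_congr rfl fun i hi => by
      simp [Equiv.swap_apply_of_ne_of_ne (ne_of_mem_of_not_mem hi hp)
        (ne_of_mem_of_not_mem hi hj)]
  rw [this]
  simp

theorem two_mul_sum_aomoto_pole (T : L →+ ℚ) {x : ι → L} (hx : Function.Injective x) (w : L)
    {S : Finset ι} {p : ι} (hp : p ∉ S) (j : ι) :
    2 * ∑ σ : Equiv.Perm ι, T ((∏ i ∈ S, x (σ i)) *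
        ((x (σ p) - x (σ p) ^ 2) / (x (σ j) - x (σ p))) * w) =
      if j = p then 0 else if j ∈ S then aomotoMean T x w (insert p S) else
        2 * aomotoMean T x w (insert p S) - aomotoMean T x w S := by
  rcases eq_or_ne j p with rfl | hjp
  · simp
  rw [if_neg hjp, two_mul]
  nth_rewrite 2 [← Equiv.sum_comp (Equiv.mulRight (Equiv.swap p j))]
  rw [← sum_add_distrib]
  have hne : ∀ σ : Equiv.Perm ι, x (σ j) - x (σ p) ≠ 0 := fun σ =>
    sub_ne_zero.2 (hx.ne (σ.injective.ne hjp))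
  have hne' : ∀ σ : Equiv.Perm ι, x (σ p) - x (σ j) ≠ 0 := fun σ =>
    sub_ne_zero.2 (hx.ne (σ.injective.ne hjp.symm))
  split_ifs with hjS
  · refine sum_congr rfl fun σ _ => ?_
    rw [← map_add, prod_insert hp]
    congr 1
    rw [← mul_prod_erase S _ hjS, ← mul_prod_erase S _ hjS]
    have : ∏ i ∈ S.erase j, x ((Equiv.mulRight (Equiv.swap p j)) σ i) =
        ∏ i ∈ S.erase j, x (σ i) :=
      prod_congr rfl fun i hi => by
        simp [Equiv.swap_apply_of_ne_of_ne (ne_of_mem_of_not_mem (mem_of_mem_erase hi) hp)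
          (ne_of_mem_erase hi)]
    rw [this]
    simp only [Equiv.coe_mulRight, Equiv.Perm.mul_apply, Equiv.swap_apply_left,
      Equiv.swap_apply_right]
    have := hne σ
    have h' : x (σ p) - x (σ j) = -(x (σ j) - x (σ p)) := by ring
    rw [h', div_neg]
    field_simp
    ring
  · have hsym := aomotoMean_insert_eq T x w hp hjS
    have : 2 * aomotoMean T x w (insert p S) - aomotoMean T x w S =
        aomotoMean T x w (insert p S) + aomotoMean T x w (insert j S) - aomotoMean T x w S := by
      rw [hsym]; ring
    rw [this]
    unfold aomotoMean
    rw [← sum_add_distrib, ← sum_sub_distrib]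
    refine sum_congr rfl fun σ _ => ?_
    rw [← map_add, ← map_add, ← map_sub, prod_insert hp, prod_insert hjS]
    congr 1
    have : ∏ i ∈ S, x ((Equiv.mulRight (Equiv.swap p j)) σ i) = ∏ i ∈ S, x (σ i) :=
      prod_congr rfl fun i hi => by
        simp [Equiv.swap_apply_of_ne_of_ne (ne_of_mem_of_not_mem hi hp)
          (ne_of_mem_of_not_mem hi hjS)]
    rw [this]
    simp only [Equiv.coe_mulRight, Equiv.Perm.mul_apply, Equiv.swap_apply_left,
      Equiv.swap_apply_right]
    have := hne σ
    have h' : x (σ p) - x (σ j) = -(x (σ j) - x (σ p)) := by ring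
    rw [h', div_neg]
    field_simp
    ring

/-- The Aomoto recursion. -/
theorem aomotoMean_insert (T : L →+ ℚ) {x : ι → L} (hx : Function.Injective x)
    (hx1 : ∀ i, x i ≠ 1) {w : L} (a b m : ℕ) (D : ι → Derivation ℤ L L)
    (hT : ∀ i f, T (D i f) = 0) (hD : ∀ i j, D i (x j) = if j = i then x j else 0)
    (hw : ∀ i, D i w = w * (a * x i / (1 - x i) - b + m * ∑ j, x i / (x j - x i)))
    {S : Finset ι} {p : ι} (hp : p ∉ S) :
    aomotoMean T x w (insert p S) *
        (2 * ((a : ℚ) + b - 1) + m * (2 * Fintype.card ι - S.card - 2)) =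
      aomotoMean T x w S * (2 * b + m * (Fintype.card ι - S.card - 1)) := by
  have hmul : ∀ (k : ℕ) (f : L), T (k * f) = k * T f := fun k f => by
    rw [← nsmul_eq_mul, map_nsmul, nsmul_eq_mul]
  have hterm : ∀ σ : Equiv.Perm ι,
      D (σ p) ((1 - x (σ p)) * (∏ i ∈ S, x (σ i)) * w) =
      ((a : L) * ((∏ i ∈ insert p S, x (σ i)) * w) + b * ((∏ i ∈ insert p S, x (σ i)) * w) -
        (∏ i ∈ insert p S, x (σ i)) * w - b * ((∏ i ∈ S, x (σ i)) * w)) +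
      m * ∑ j, (∏ i ∈ S, x (σ i)) *
        ((x (σ p) - x (σ p) ^ 2) / (x (σ j) - x (σ p))) * w := fun σ => by
    have h1 : D (σ p) (∏ i ∈ S, x (σ i)) = 0 := by
      rw [(D (σ p)).apply_prod_of_log S (α := fun _ => 0)]
      · simp
      · intro i hi
        rw [hD, if_neg (σ.injective.ne (ne_of_mem_of_not_mem hi hp))]; simp
    have h2 : D (σ p) (1 - x (σ p)) = - x (σ p) := by
      rw [map_sub, hD, if_pos rfl, Derivation.map_one_eq_zero, zero_sub]
    have h3 : ∑ j, (∏ i ∈ S, x (σ i)) *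
          ((x (σ p) - x (σ p) ^ 2) / (x (σ j) - x (σ p))) * w =
        (∏ i ∈ S, x (σ i)) * (1 - x (σ p)) * w * ∑ j, x (σ p) / (x j - x (σ p)) := by
      rw [← Equiv.sum_comp σ (fun j => x (σ p) / (x j - x (σ p))), mul_sum]
      refine sum_congr rfl fun j _ => ?_
      ring
    rw [h3, Derivation.leibniz, Derivation.leibniz, h1, h2, hw, prod_insert hp]
    simp only [smul_eq_mul]
    have := sub_ne_zero.2 (hx1 (σ p)).symm
    field_simp
    ring
  have hsum := sum_congr rfl fun (σ : Equiv.Perm ι) (_ : σ ∈ univ) =>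
    (hT (σ p) ((1 - x (σ p)) * (∏ i ∈ S, x (σ i)) * w)).symm.trans
      (congrArg T (hterm σ))
  simp only [map_add, map_sub, hmul, map_sum, sum_add_distrib, sum_sub_distrib, ← mul_sum,
    sum_const_zero] at hsum
  rw [sum_comm] at hsum
  change 0 = _ * aomotoMean T x w (insert p S) + _ * aomotoMean T x w (insert p S) -
    aomotoMean T x w (insert p S) - _ * aomotoMean T x w S + _ at hsum
  have hpole := sum_congr rfl fun (j : ι) (_ : j ∈ univ) =>
    two_mul_sum_aomoto_pole T hx w hp j
  rw [← mul_sum, ← add_sum_erase univ (fun j => if j = p then (0 : ℚ) else _) (mem_univ p),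
    if_pos rfl, zero_add,
    sum_congr rfl fun j hj => if_neg (ne_of_mem_erase hj), sum_ite, sum_const, sum_const,
    nsmul_eq_mul, nsmul_eq_mul] at hpole
  have hf1 : (univ.erase p).filter (· ∈ S) = S := by
    ext j; simp only [mem_filter, mem_erase, mem_univ, and_true, and_iff_right_iff_imp]
    exact fun h => ne_of_mem_of_not_mem h hp
  have hc := card_filter_add_card_filter_not (s := univ.erase p) (· ∈ S)
  rw [hf1, card_erase_of_mem (mem_univ p), card_univ] at hc
  have hpos : 0 < Fintype.card ι := Fintype.card_pos_iff.2 ⟨p⟩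
  have hc' : ((#{j ∈ univ.erase p | j ∉ S} : ℕ) : ℚ) = Fintype.card ι - 1 - S.card := by
    rw [eq_sub_iff_add_eq, eq_sub_iff_add_eq]; norm_cast; omega
  rw [hf1, hc'] at hpole
  linear_combination 2 * hsum.symm - m * hpole

theorem aomotoMean_eq (T : L →+ ℚ) {x : ι → L} (hx : Function.Injective x)
    (hx1 : ∀ i, x i ≠ 1) {w : L} (a b m : ℕ) (D : ι → Derivation ℤ L L)
    (hT : ∀ i f, T (D i f) = 0) (hD : ∀ i j, D i (x j) = if j = i then x j else 0)
    (hw : ∀ i, D i w = w * (a * x i / (1 - x i) - b + m * ∑ j, x i / (x j - x i)))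
    (S : Finset ι) :
    aomotoMean T x w S *
        ∏ l ∈ range S.card, (2 * ((a : ℚ) + b - 1) + m * (2 * Fintype.card ι - l - 2)) =
      aomotoMean T x w ∅ *
        ∏ l ∈ range S.card, (2 * (b : ℚ) + m * (Fintype.card ι - l - 1)) := by
  induction S using Finset.induction_on with
  | empty => simp
  | insert p S hp ih =>
    rw [card_insert_of_notMem hp, prod_range_succ, prod_range_succ, ← mul_assoc (aomotoMean T x w ∅),
      ← ih]
    linear_combination (∏ l ∈ range S.card,
      (2 * ((a : ℚ) + b - 1) + m * (2 * Fintype.card ι - l - 2))) *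
      aomotoMean_insert T hx hx1 a b m D hT hD hw hp

end Aomoto

/-- Lowering `b` by one multiplies the constant term by an explicit factor. -/
theorem morrisWeight_recursion {L : Type*} [Field L] {n : ℕ} (T : L →+ ℚ) {x : Fin n → L}
    (hx : Function.Injective x) (hx0 : ∀ i, x i ≠ 0) (hx1 : ∀ i, x i ≠ 1) (a b m : ℕ)
    (D : Fin n → Derivation ℤ L L) (hT : ∀ i f, T (D i f) = 0)
    (hD : ∀ i j, D i (x j) = if j = i then x j else 0) :
    T (morrisWeight x a b m) * ∏ j ∈ range n, ((a : ℚ) + b + (n - 1 + j) * m / 2) =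
      T (morrisWeight x a (b + 1) m) * ∏ j ∈ range n, ((b : ℚ) + 1 + j * m / 2) := by
  have h := aomotoMean_eq T hx hx1 a (b + 1) m D hT hD
    (fun i => derivation_morrisWeight hx hx1 a (b + 1) m i (D i) (hD i)) univ
  have cast_reflect : ∀ j < n, ((n - 1 - j : ℕ) : ℚ) = n - 1 - j := fun j hj => by
    rw [eq_sub_iff_add_eq, eq_sub_iff_add_eq]; norm_cast; omega
  have hlow : ∀ σ : Equiv.Perm (Fin n), (∏ i, x (σ i)) * morrisWeight x a (b + 1) m =
      morrisWeight x a b m := fun σ => by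
    have : (∏ i, x i) * ∏ i, (x i ^ (b + 1))⁻¹ = ∏ i, (x i ^ b)⁻¹ := by
      rw [← prod_mul_distrib]
      refine prod_congr rfl fun i _ => ?_
      have := hx0 i
      rw [pow_succ]; field_simp
    rw [Equiv.prod_comp σ x, morrisWeight, morrisWeight, ← this]
    ring
  simp only [aomotoMean, hlow, prod_empty, one_mul, sum_const, nsmul_eq_mul, card_univ,
    Fintype.card_fin] at h
  rw [← prod_range_reflect (fun l : ℕ => 2 * ((a : ℚ) + ((b + 1 : ℕ) : ℚ) - 1) +
      m * (2 * n - (l : ℚ) - 2)),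
    ← prod_range_reflect (fun l : ℕ => 2 * ((b + 1 : ℕ) : ℚ) + m * (n - (l : ℚ) - 1))] at h
  have e1 : ∏ j ∈ range n, (2 * ((a : ℚ) + ((b + 1 : ℕ) : ℚ) - 1) +
      m * (2 * n - ((n - 1 - j : ℕ) : ℚ) - 2)) =
      (∏ j ∈ range n, (2 : ℚ)) * ∏ j ∈ range n, ((a : ℚ) + b + (n - 1 + j) * m / 2) := by
    rw [← prod_mul_distrib]
    refine prod_congr rfl fun j hj => ?_
    rw [cast_reflect j (mem_range.1 hj)]
    push_cast; ring
  have e2 : ∏ j ∈ range n, (2 * ((b + 1 : ℕ) : ℚ) + m * (n - ((n - 1 - j : ℕ) : ℚ) - 1)) =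
      (∏ j ∈ range n, (2 : ℚ)) * ∏ j ∈ range n, ((b : ℚ) + 1 + j * m / 2) := by
    rw [← prod_mul_distrib]
    refine prod_congr rfl fun j hj => ?_
    rw [cast_reflect j (mem_range.1 hj)]
    push_cast; ring
  rw [e1, e2] at h
  have hne : ((Fintype.card (Equiv.Perm (Fin n)) : ℕ) : ℚ) * ∏ j ∈ range n, (2 : ℚ) ≠ 0 := by
    simp [Fintype.card_ne_zero]
  refine mul_left_cancel₀ hne ?_
  linear_combination h
theorem LaurentSeries.exists_leibniz {K : Type*} [Field K] (d : ℤ → K →+ K)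
    (hd : ∀ i j u v, d (i + j) (u * v) = u * d j v + v * d i u) :
    ∃ D : LaurentSeries K →+ LaurentSeries K,
      (∀ f g, D (f * g) = f * D g + g * D f) ∧ ∀ f k, (D f).coeff k = d k (f.coeff k) := by
  have hsupp : ∀ f : LaurentSeries K, Function.support (fun k => d k (f.coeff k)) ⊆
      HahnSeries.support f :=
    fun f k hk h0 => hk (by simp [h0])
  let D : LaurentSeries K →+ LaurentSeries K :=
    { toFun := fun f => ⟨fun k => d k (f.coeff k), f.isPWO_support.mono (hsupp f)⟩
      map_zero' := by ext; simp
      map_add' := fun f g => by ext; simp }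
  refine ⟨D, fun f g => ?_, fun f k => rfl⟩
  ext k
  rw [mul_comm g, HahnSeries.coeff_add,
    HahnSeries.coeff_mul_left' f.isPWO_support (x := D f) (hsupp f),
    HahnSeries.coeff_mul_right' g.isPWO_support (y := D g) (hsupp g), ← sum_add_distrib]
  change d k ((f * g).coeff k) = _
  rw [HahnSeries.coeff_mul, map_sum]
  refine sum_congr rfl fun p hp => ?_
  rw [← (mem_antidiagonal.1 hp).2.2, hd]
  change _ = _ * d _ _ + d _ _ * _
  ring

theorem LaurentSeries.single_one_ne_C {K : Type*} [Field K] (c : K) :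
    HahnSeries.single (1 : ℤ) (1 : K) ≠ HahnSeries.C c := fun h => by
  have := congrArg (fun f => f.coeff 1) h
  simp [HahnSeries.C_apply] at this

namespace IterLaurent

/-- The outermost variable presented as a Laurent series ring. -/
noncomputable def succEquiv (n : ℕ) : IterLaurent (n + 1) ≃+* LaurentSeries (IterLaurent n) :=
  RingEquiv.refl _

theorem succEquiv_X_zero (n : ℕ) :
    succEquiv n (X (n + 1) 0) = HahnSeries.single (1 : ℤ) (1 : IterLaurent n) := rfl

theorem succEquiv_X_succ (n : ℕ) (j : Fin n) :
    succEquiv n (X (n + 1) j.succ) = HahnSeries.C (X n j) := rfl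

theorem CT_succ (n : ℕ) (f : IterLaurent (n + 1)) :
    CT (n + 1) f = CT n ((succEquiv n f).coeff 0) := rfl

theorem CT_add : ∀ (n : ℕ) (f g : IterLaurent n), CT n (f + g) = CT n f + CT n g
  | 0, _, _ => rfl
  | n + 1, f, g => by
    rw [CT_succ, CT_succ, CT_succ, map_add, HahnSeries.coeff_add, CT_add n]

theorem CT_zero (n : ℕ) : CT n 0 = 0 := by
  simpa using CT_add n 0 0

/-- The constant term as an additive map. -/
noncomputable def CTHom (n : ℕ) : IterLaurent n →+ ℚ where
  toFun := CT n
  map_zero' := CT_zero n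
  map_add' := CT_add n

theorem X_ne_one : ∀ (n : ℕ) (i : Fin n), X n i ≠ 1
  | n + 1, i => fun h => by
    have h' := congrArg (succEquiv n) h
    rw [map_one, ← HahnSeries.C_one] at h'
    induction i using Fin.cases with
    | zero => exact LaurentSeries.single_one_ne_C _ h'
    | succ i => exact X_ne_one n i (HahnSeries.C_injective h')

theorem X_ne_zero : ∀ (n : ℕ) (i : Fin n), X n i ≠ 0
  | n + 1, i => fun h => by
    have h' := congrArg (succEquiv n) h
    rw [map_zero, ← HahnSeries.C_zero] at h'
    induction i using Fin.cases with
    | zero => exact LaurentSeries.single_one_ne_C _ h'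
    | succ i => exact X_ne_zero n i (HahnSeries.C_injective h')

theorem X_injective : ∀ n : ℕ, Function.Injective (X n)
  | 0 => fun i => i.elim0
  | n + 1 => fun i j h => by
    have h' := congrArg (succEquiv n) h
    induction i using Fin.cases with
    | zero =>
      induction j using Fin.cases with
      | zero => rfl
      | succ j => exact absurd h' (LaurentSeries.single_one_ne_C _)
    | succ i =>
      induction j using Fin.cases with
      | zero => exact absurd h'.symm (LaurentSeries.single_one_ne_C _)
      | succ j => exact congrArg Fin.succ (X_injective n (HahnSeries.C_injective h'))

theorem exists_derivation_succ (n : ℕ) (d : ℤ → IterLaurent n →+ IterLaurent n)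
    (hd : ∀ i j u v, d (i + j) (u * v) = u * d j v + v * d i u) :
    ∃ D : Derivation ℤ (IterLaurent (n + 1)) (IterLaurent (n + 1)),
      ∀ f k, (succEquiv n (D f)).coeff k = d k ((succEquiv n f).coeff k) := by
  obtain ⟨D, hD, hDc⟩ := LaurentSeries.exists_leibniz d hd
  refine ⟨Derivation.mk' (((succEquiv n).symm.toAddMonoidHom.comp
    (D.comp (succEquiv n).toAddMonoidHom)).toIntLinearMap) fun f g => ?_, fun f k => ?_⟩
  · change (succEquiv n).symm (D (succEquiv n (f * g))) =
      f * (succEquiv n).symm (D (succEquiv n g)) + g * (succEquiv n).symm (D (succEquiv n f))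
    simp [hD]
  · change (succEquiv n ((succEquiv n).symm (D (succEquiv n f)))).coeff k = _
    simp [hDc]

/-- The Euler operators `x_i ∂/∂x_i`. -/
theorem exists_eulerDerivation : ∀ (n : ℕ) (i : Fin n),
    ∃ D : Derivation ℤ (IterLaurent n) (IterLaurent n), (∀ f, CT n (D f) = 0) ∧
      ∀ j, D (X n j) = if j = i then X n j else 0
  | n + 1, i => by
    induction i using Fin.cases with
    | zero =>
      obtain ⟨D, hD⟩ := exists_derivation_succ n
        (fun k => AddMonoidHom.mulLeft (k : IterLaurent n)) fun i j u v => by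
          simp only [AddMonoidHom.coe_mulLeft]; push_cast; ring
      refine ⟨D, fun f => by rw [CT_succ, hD]; simp [CT_zero], fun j => ?_⟩
      apply (succEquiv n).injective
      ext k
      rw [hD]
      induction j using Fin.cases with
      | zero =>
        rw [if_pos rfl, succEquiv_X_zero, HahnSeries.coeff_single]
        split_ifs with h <;> simp [h]
      | succ j =>
        rw [if_neg (Fin.succ_ne_zero j), succEquiv_X_succ, HahnSeries.C_apply,
          HahnSeries.coeff_single]
        split_ifs with h <;> simp [h]
    | succ i =>
      obtain ⟨D', hT, hX⟩ := exists_eulerDerivation n i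
      obtain ⟨D, hD⟩ := exists_derivation_succ n (fun _ => D'.toLinearMap.toAddMonoidHom)
        fun i j u v => D'.leibniz u v
      have hD' : ∀ f k, (succEquiv n (D f)).coeff k = D' ((succEquiv n f).coeff k) := hD
      refine ⟨D, fun f => by rw [CT_succ, hD', hT], fun j => ?_⟩
      apply (succEquiv n).injective
      ext k
      rw [hD']
      induction j using Fin.cases with
      | zero =>
        rw [if_neg (Fin.succ_ne_zero i).symm, succEquiv_X_zero, HahnSeries.coeff_single]
        split_ifs with h <;> simp
      | succ j =>
        rw [succEquiv_X_succ, HahnSeries.C_apply, HahnSeries.coeff_single]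
        by_cases hij : j = i
        · rw [if_pos (congrArg _ hij), succEquiv_X_succ, HahnSeries.C_apply,
            HahnSeries.coeff_single]
          split_ifs with h <;> simp [hX, hij]
        · rw [if_neg ((Fin.succ_injective n).ne hij)]
          split_ifs with h <;> simp [hX, hij]

end IterLaurent

theorem LaurentSeries.coeff_zero_inv_ofPowerSeries {K : Type*} [Field K] (Q : PowerSeries K)
    (hQ : PowerSeries.constantCoeff Q ≠ 0) :
    (HahnSeries.ofPowerSeries ℤ K Q)⁻¹.coeff 0 = (PowerSeries.constantCoeff Q)⁻¹ := by
  have : (HahnSeries.ofPowerSeries ℤ K Q)⁻¹ = HahnSeries.ofPowerSeries ℤ K Q⁻¹ := by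
    refine inv_eq_of_mul_eq_one_right ?_
    rw [← map_mul, PowerSeries.mul_inv_cancel _ hQ, map_one]
  rw [this]
  have h := HahnSeries.ofPowerSeries_apply_coeff (Γ := ℤ) Q⁻¹ 0
  simpa using h

theorem prod_filter_lt_succ {M : Type*} [CommMonoid M] {n : ℕ}
    (g : Fin (n + 1) × Fin (n + 1) → M) :
    ∏ p ∈ univ.filter (fun p : Fin (n + 1) × Fin (n + 1) => p.1 < p.2), g p =
      (∏ j : Fin n, g (0, j.succ)) *
        ∏ p ∈ univ.filter (fun p : Fin n × Fin n => p.1 < p.2), g (p.1.succ, p.2.succ) := by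
  simp only [prod_filter, Fintype.prod_prod_type, Fin.prod_univ_succ, Fin.not_lt_zero,
    if_false, one_mul, Fin.succ_lt_succ_iff, Fin.succ_pos, if_true]

/-- At `b = 0` the integrand is a power series in the outermost variable `x_1`, so setting
`x_1 = 0` leaves the same integrand with one variable fewer and `b = m`. -/
theorem IterLaurent.CT_morrisWeight_zero (n a m : ℕ) :
    CT (n + 1) (morrisWeight (X (n + 1)) a 0 m) = CT n (morrisWeight (X n) a m m) := by
  let Y : Fin (n + 1) → PowerSeries (IterLaurent n) :=
    Fin.cons PowerSeries.X fun j => PowerSeries.C (X n j)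
  have hY : ∀ i, succEquiv n (X (n + 1) i) = HahnSeries.ofPowerSeries ℤ _ (Y i) := fun i => by
    induction i using Fin.cases with
    | zero => rw [succEquiv_X_zero]; simp [Y]
    | succ i => rw [succEquiv_X_succ]; simp [Y]
  let Q : PowerSeries (IterLaurent n) := (∏ i, (1 - Y i) ^ a) *
    ∏ p ∈ univ.filter (fun p : Fin (n + 1) × Fin (n + 1) => p.1 < p.2), (Y p.2 - Y p.1) ^ m
  have hQ : succEquiv n (morrisWeight (X (n + 1)) a 0 m) =
      (HahnSeries.ofPowerSeries ℤ _ Q)⁻¹ := by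
    simp only [morrisWeight, Q, map_mul, map_prod, map_inv₀, map_pow, map_sub, map_one, hY,
      pow_zero, inv_one, prod_const_one, mul_one, prod_inv_distrib, mul_inv]
  have hc : PowerSeries.constantCoeff Q = (morrisWeight (X n) a m m)⁻¹ := by
    simp only [Q, map_mul, map_prod, map_pow, map_sub, map_one, prod_filter_lt_succ,
      Fin.prod_univ_succ, Y, Fin.cons_zero, Fin.cons_succ, PowerSeries.constantCoeff_X,
      PowerSeries.constantCoeff_C, sub_zero, one_pow, one_mul, morrisWeight, mul_inv,
      prod_inv_distrib, inv_inv, mul_assoc]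
  have hne : morrisWeight (X n) a m m ≠ 0 := by
    refine mul_ne_zero (mul_ne_zero ?_ ?_) ?_ <;> refine prod_ne_zero_iff.2 fun p hp => ?_
    · exact inv_ne_zero (pow_ne_zero _ (sub_ne_zero.2 (X_ne_one n p).symm))
    · exact inv_ne_zero (pow_ne_zero _ (X_ne_zero n p))
    · exact inv_ne_zero (pow_ne_zero _
        (sub_ne_zero.2 ((X_injective n).ne (mem_filter.1 hp).2.ne')))
  rw [CT_succ, hQ, LaurentSeries.coeff_zero_inv_ofPowerSeries Q (hc ▸ inv_ne_zero hne), hc, inv_inv]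

theorem IterLaurent.CT_morrisWeight_recursion (n a b m : ℕ) :
    CT n (morrisWeight (X n) a b m) * ∏ j ∈ range n, ((a : ℚ) + b + (n - 1 + j) * m / 2) =
      CT n (morrisWeight (X n) a (b + 1) m) * ∏ j ∈ range n, ((b : ℚ) + 1 + j * m / 2) := by
  choose D hT hD using exists_eulerDerivation n
  exact morrisWeight_recursion (CTHom n) (X_injective n) (X_ne_zero n) (X_ne_one n) a b m D hT hD

/-- The right-hand side of the Morris identity. -/
noncomputable def morrisValue (n a b m : ℕ) : ℝ :=
  (1 / (Nat.factorial n : ℝ)) *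
    ∏ j ∈ Finset.range n,
      (Real.Gamma ((a : ℝ) + b + ((n : ℝ) - 1 + j) * m / 2) *
          Real.Gamma ((m : ℝ) / 2)) /
        (Real.Gamma ((a : ℝ) + j * m / 2) *
          Real.Gamma ((m : ℝ) / 2 + j * m / 2) *
          Real.Gamma ((b : ℝ) + j * m / 2 + 1))

theorem sub_one_add_nonneg {n j : ℕ} (hj : j ∈ range n) : (0 : ℝ) ≤ (n : ℝ) - 1 + j := by
  have : (1 : ℝ) ≤ n := by exact_mod_cast (Nat.one_le_of_lt (mem_range.1 hj))
  linarith [j.cast_nonneg (α := ℝ)]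

theorem morrisValue_recursion (n a b m : ℕ) (ha : 1 ≤ a) :
    morrisValue n a b m * ∏ j ∈ range n, ((a : ℝ) + b + (n - 1 + j) * m / 2) =
      morrisValue n a (b + 1) m * ∏ j ∈ range n, ((b : ℝ) + 1 + j * m / 2) := by
  rw [morrisValue, morrisValue, mul_assoc, mul_assoc, ← prod_mul_distrib, ← prod_mul_distrib]
  congr 1
  refine prod_congr rfl fun j hj => ?_
  have ha' : (0 : ℝ) < a := by exact_mod_cast ha
  have h1 : (0 : ℝ) < a + b + (n - 1 + j) * m / 2 := by
    have := sub_one_add_nonneg hj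
    positivity
  have h2 : (0 : ℝ) < b + 1 + j * m / 2 := by positivity
  have e1 : (a : ℝ) + ((b + 1 : ℕ) : ℝ) + (n - 1 + j) * m / 2 =
      a + b + (n - 1 + j) * m / 2 + 1 := by push_cast; ring
  have e2 : ((b + 1 : ℕ) : ℝ) + j * m / 2 + 1 = b + 1 + j * m / 2 + 1 := by push_cast; ring
  have e3 : (b : ℝ) + j * m / 2 + 1 = b + 1 + j * m / 2 := by ring
  rw [e1, e2, e3, Real.Gamma_add_one h1.ne', Real.Gamma_add_one h2.ne', ← mul_assoc (_ * _),
    mul_comm (_ * _) (_ : ℝ)]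
  have := h2.ne'
  field_simp

theorem morrisValue_zero_right (n a m : ℕ) (ha : 1 ≤ a) (hm : 1 ≤ m) :
    morrisValue (n + 1) a 0 m = morrisValue n a m m := by
  have ha' : (0 : ℝ) < a := by exact_mod_cast ha
  have hm' : (0 : ℝ) < m := by exact_mod_cast hm
  have hG : ∀ {s : ℝ}, 0 < s → Real.Gamma s ≠ 0 := fun h => (Real.Gamma_pos_of_pos h).ne'
  let A : ℕ → ℝ := fun k => Real.Gamma (a + k * m / 2)
  let B : ℕ → ℝ := fun k => Real.Gamma (k * m / 2 + 1)
  let C : ℕ → ℝ := fun k => Real.Gamma (m / 2 + k * m / 2)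
  have hA : ∀ k, A k ≠ 0 := fun k => hG (by positivity)
  have hB : ∀ k, B k ≠ 0 := fun k => hG (by positivity)
  have hC : ∀ k, C k ≠ 0 := fun k => hG (by positivity)
  have h0 : Real.Gamma ((m : ℝ) / 2) ≠ 0 := hG (by positivity)
  have hl : morrisValue (n + 1) a 0 m = (1 / ((n + 1).factorial : ℝ)) *
      ∏ j ∈ range (n + 1), (A (n + j) * C 0) / (A j * C j * B j) := by
    unfold morrisValue
    congr 1
    refine prod_congr rfl fun j _ => ?_
    simp only [A, B, C]
    rw [show (a : ℝ) + (0 : ℕ) + (((n + 1 : ℕ) : ℝ) - 1 + j) * m / 2 =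
        a + ((n + j : ℕ) : ℝ) * m / 2 by push_cast; ring,
      show (m : ℝ) / 2 + (0 : ℕ) * m / 2 = m / 2 by push_cast; ring,
      show ((0 : ℕ) : ℝ) + j * m / 2 + 1 = j * m / 2 + 1 by push_cast; ring]
  have hr : morrisValue n a m m = (1 / (n.factorial : ℝ)) *
      ∏ j ∈ range n, (A (n + j + 1) * C 0) / (A j * C j * B (j + 2)) := by
    unfold morrisValue
    congr 1
    refine prod_congr rfl fun j _ => ?_
    simp only [A, B, C]
    rw [show (a : ℝ) + m + ((n : ℝ) - 1 + j) * m / 2 =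
        a + ((n + j + 1 : ℕ) : ℝ) * m / 2 by push_cast; ring,
      show (m : ℝ) / 2 + (0 : ℕ) * m / 2 = m / 2 by push_cast; ring,
      show (m : ℝ) + j * m / 2 + 1 = ((j + 2 : ℕ) : ℝ) * m / 2 + 1 by push_cast; ring]
  have hBC : B (n + 1) * C 0 = (n + 1) * B 1 * C n := by
    have e1 : B (n + 1) = (m / 2 + n * m / 2) * C n := by
      simp only [B, C]
      rw [← Real.Gamma_add_one (by positivity)]
      congr 1; push_cast; ring
    have e2 : B 1 = m / 2 * C 0 := by
      simp only [B, C, Nat.cast_one, Nat.cast_zero, one_mul, zero_mul, zero_div, add_zero]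
      rw [← Real.Gamma_add_one (by positivity)]
    rw [e1, e2]; ring
  have hB0 : B 0 = 1 := by simp [B]
  have p2 : (∏ j ∈ range n, B (j + 2)) * B 1 * B 0 = (∏ j ∈ range n, B j) * B n * B (n + 1) := by
    rw [← prod_range_succ, ← prod_range_succ, prod_range_succ', prod_range_succ']
  rw [hl, hr]
  simp only [prod_div_distrib, prod_mul_distrib]
  rw [prod_range_succ' (fun j => A (n + j)), prod_range_succ A, prod_range_succ B,
    prod_range_succ C, prod_range_succ (fun _ => C 0), Nat.factorial_succ]
  have q1 : ∏ j ∈ range n, A j ≠ 0 := prod_ne_zero_iff.2 fun k _ => hA k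
  have q2 : ∏ j ∈ range n, B j ≠ 0 := prod_ne_zero_iff.2 fun k _ => hB k
  have q3 : ∏ j ∈ range n, C j ≠ 0 := prod_ne_zero_iff.2 fun k _ => hC k
  have q4 : ∏ j ∈ range n, B (j + 2) ≠ 0 := prod_ne_zero_iff.2 fun k _ => hB _
  have hf : (n.factorial : ℝ) ≠ 0 := by positivity
  have hn1 : (n : ℝ) + 1 ≠ 0 := by positivity
  rw [hB0, mul_one] at p2
  push_cast
  simp only [add_zero, ← add_assoc]
  rw [div_mul_div_comm, div_mul_div_comm, div_eq_div_iff
    (mul_ne_zero (mul_ne_zero hn1 hf) (mul_ne_zero (mul_ne_zero (mul_ne_zero q1 (hA n))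
      (mul_ne_zero q3 (hC n))) (mul_ne_zero q2 (hB n))))
    (mul_ne_zero hf (mul_ne_zero (mul_ne_zero q1 q3) q4))]
  refine mul_left_cancel₀ (hB 1) ?_
  linear_combination (∏ j ∈ range n, A (n + j + 1)) * A n * (∏ _j ∈ range n, C 0) *
    n.factorial * (∏ j ∈ range n, A j) * (∏ j ∈ range n, C j) *
    (C 0 * p2 + (∏ j ∈ range n, B j) * B n * hBC)

theorem IterLaurent.CT_morrisWeight (a m : ℕ) (ha : 1 ≤ a) (hm : 1 ≤ m) : ∀ n b : ℕ,
    ((CT n (morrisWeight (X n) a b m) : ℚ) : ℝ) = morrisValue n a b m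
  | 0, b => by
    have : morrisWeight (X 0) a b m = 1 := by simp [morrisWeight]
    rw [this, morrisValue]
    have h1 : CT 0 1 = 1 := rfl
    simp [h1]
  | n + 1, 0 => by
    rw [CT_morrisWeight_zero, CT_morrisWeight a m ha hm n m, morrisValue_zero_right n a m ha hm]
  | n + 1, b + 1 => by
    have hpos : ∏ j ∈ range (n + 1), ((b : ℝ) + 1 + j * m / 2) ≠ 0 :=
      prod_ne_zero_iff.2 fun j _ => by positivity
    refine mul_right_cancel₀ hpos ?_
    rw [← morrisValue_recursion _ _ _ _ ha, ← CT_morrisWeight a m ha hm (n + 1) b]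
    have h := congrArg (Rat.cast : ℚ → ℝ) (CT_morrisWeight_recursion (n + 1) a b m)
    push_cast at h ⊢
    exact h.symm

/-- **The Morris constant term identity** (half-integer parameter form, `c = m/2`):
for `n ≥ 1`, `a ≥ 1`, `b ≥ 0` and `m ≥ 1`, the coefficient of `x_1^0 ⋯ x_n^0` in
`∏_{i=1}^{n}(1-x_i)^{-a} ∏_{i=1}^{n} x_i^{-b} ∏_{1 ≤ i < j ≤ n}(x_j-x_i)^{-m}`,
computed in the iterated Laurent series field `ℚ((x_n))⋯((x_1))` and viewed as a
real number, equals
`(1/n!) ∏_{j=0}^{n-1} Γ(a+b+(n-1+j)m/2)Γ(m/2) / (Γ(a+jm/2)Γ(m/2+jm/2)Γ(b+jm/2+1))`. -/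
theorem morris_constant_term_identity (n a b m : ℕ)
    (hn : 1 ≤ n) (ha : 1 ≤ a) (hm : 1 ≤ m) :
    ((IterLaurent.CT n
      ((∏ i : Fin n, ((1 - IterLaurent.X n i) ^ a)⁻¹) *
        (∏ i : Fin n, ((IterLaurent.X n i) ^ b)⁻¹) *
        ∏ p ∈ Finset.univ.filter (fun p : Fin n × Fin n => p.1 < p.2),
          ((IterLaurent.X n p.2 - IterLaurent.X n p.1) ^ m)⁻¹) : ℚ) : ℝ) =
      (1 / (Nat.factorial n : ℝ)) *
        ∏ j ∈ Finset.range n,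
          (Real.Gamma ((a : ℝ) + b + ((n : ℝ) - 1 + j) * m / 2) *
              Real.Gamma ((m : ℝ) / 2)) /
            (Real.Gamma ((a : ℝ) + j * m / 2) *
              Real.Gamma ((m : ℝ) / 2 + j * m / 2) *
              Real.Gamma ((b : ℝ) + j * m / 2 + 1)) := by
  exact IterLaurent.CT_morrisWeight a m ha hm n b
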